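/- Let m ≥ 2 and let a, b be integers with m ≤ a < b such that a ≢ −1 (mod p) and b ≢ −1 (mod p) for every prime p dividing m. For each integer j with a+1 ≤ j ≤ b and each ℓ ∈ {0, 1, …, m−1}, let N_j(ℓ) denote the number of partitions with at most m−2 parts, each part at most j−m+1, whose size is congruent to ℓ − (j−a−1) modulo m. Then for every ℓ ∈ {0, 1, …, m−1}: ∑_{j=a+1}^{b} N_j(ℓ) = (1/m) · ∑_{j=a+1}^{b} C(j−1, m−2). In particular m divides ∑_{j=a+1}^{b} C(j−1, m−2). -/

import Mathlib

/-- A partition: a weakly decreasing list of positive integers. -/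
def IsPartition (l : List ℕ) : Prop :=
  l.Pairwise (· ≥ ·) ∧ ∀ x ∈ l, 0 < x

/-- The `i`-th part (0-indexed), with parts beyond the length equal to 0. -/
def part (l : List ℕ) (i : ℕ) : ℕ := l.getD i 0

/-- Diagram containment `l ⊆ m`: every part of `l` is at most the corresponding part of `m`. -/
def SubDiag (l m : List ℕ) : Prop := ∀ i, part l i ≤ part m i

open Polynomial

/-- The `q`-integer `1 + X + ⋯ + X ^ (n - 1)`. -/
noncomputable def qInt (n : ℕ) : ℤ[X] := ∑ i ∈ Finset.range n, X ^ i

/-- The partitions with at most `k` parts, each part at most `n`. -/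
def boxPartitions : ℕ → ℕ → Finset (List ℕ)
  | 0, _ => {[]}
  | _ + 1, 0 => {[]}
  | k + 1, n + 1 =>
    boxPartitions (k + 1) n ∪ (boxPartitions k (n + 1)).image (List.cons (n + 1))

theorem mem_boxPartitions {k n : ℕ} {l : List ℕ} :
    l ∈ boxPartitions k n ↔ IsPartition l ∧ l.length ≤ k ∧ ∀ x ∈ l, x ≤ n := by
  fun_induction boxPartitions k n generalizing l with
  | case1 n =>
    cases l <;> simp [IsPartition]
  | case2 k =>
    cases l with
    | nil => simp [IsPartition]
    | cons x t =>
      simp only [Finset.mem_singleton, reduceCtorEq, false_iff]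
      rintro ⟨⟨-, h⟩, -, h'⟩
      have := h x (by simp)
      have := h' x (by simp)
      omega
  | case3 k n ih₁ ih₂ =>
    simp only [Finset.mem_union, Finset.mem_image, ih₁, ih₂]
    cases l with
    | nil => simp [IsPartition]
    | cons x t =>
      simp only [IsPartition, List.pairwise_cons, List.mem_cons, forall_eq_or_imp,
        List.length_cons, List.cons.injEq]
      constructor
      · rintro (⟨h, hlen, hx, hle⟩ | ⟨s, ⟨⟨hs, hpos⟩, hlen, hle⟩, rfl, rfl⟩)
        · exact ⟨h, hlen, by omega, fun y hy => (hle y hy).trans n.le_succ⟩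
        · exact ⟨⟨⟨hle, hs⟩, by omega, hpos⟩, by omega, le_rfl, hle⟩
      · rintro ⟨⟨⟨hge, hs⟩, hx, hpos⟩, hlen, hxn, hle⟩
        rcases hxn.eq_or_lt with rfl | hlt
        · exact .inr ⟨t, ⟨⟨hs, hpos⟩, by omega, hle⟩, rfl, rfl⟩
        · exact .inl ⟨⟨⟨hge, hs⟩, hx, hpos⟩, hlen, by omega,
            fun y hy => (hge y hy).trans (by omega)⟩

/-- The generating function by size of the partitions in a `k × n` box, that is, the Gaussian
binomial coefficient `[k + n choose k]`. -/
noncomputable def boxGenFun (k n : ℕ) : ℤ[X] := ∑ l ∈ boxPartitions k n, X ^ l.sum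

@[simp]
theorem boxGenFun_zero_left (n : ℕ) : boxGenFun 0 n = 1 := by
  simp [boxGenFun, boxPartitions]

@[simp]
theorem boxGenFun_zero_right (k : ℕ) : boxGenFun k 0 = 1 := by
  cases k <;> simp [boxGenFun, boxPartitions]

theorem boxGenFun_succ_succ (k n : ℕ) :
    boxGenFun (k + 1) (n + 1) = boxGenFun (k + 1) n + X ^ (n + 1) * boxGenFun k (n + 1) := by
  have hdisj : Disjoint (boxPartitions (k + 1) n)
      ((boxPartitions k (n + 1)).image (List.cons (n + 1))) := by
    rw [Finset.disjoint_left]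
    intro l hl hl'
    obtain ⟨t, -, rfl⟩ := Finset.mem_image.1 hl'
    have := (mem_boxPartitions.1 hl).2.2 (n + 1) List.mem_cons_self
    omega
  rw [boxGenFun, boxPartitions, Finset.sum_union hdisj,
    Finset.sum_image (List.cons_injective.injOn)]
  simp [boxGenFun, Finset.mul_sum, pow_add]

theorem eval_one_boxGenFun (k n : ℕ) : (boxGenFun k n).eval 1 = ((k + n).choose k : ℤ) := by
  fun_induction boxPartitions k n with
  | case1 n => simp
  | case2 k => simp
  | case3 k n ih₁ ih₂ =>
    rw [boxGenFun_succ_succ, eval_add, eval_mul, ih₁, ih₂, eval_pow, eval_X, one_pow, one_mul,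
      show k + 1 + (n + 1) = (k + 1 + n) + 1 by omega, Nat.choose_succ_succ,
      show k + (n + 1) = k + 1 + n by omega]
    push_cast
    ring

theorem sum_Ioc_X_pow_mul_boxGenFun (k : ℕ) {M N : ℕ} (h : M ≤ N) :
    ∑ n ∈ Finset.Ioc M N, X ^ n * boxGenFun k n = boxGenFun (k + 1) N - boxGenFun (k + 1) M := by
  induction N, h using Nat.le_induction with
  | base => simp
  | succ N h ih =>
    rw [← Finset.insert_Ioc_right_eq_Ioc_add_one h, Finset.sum_insert (by simp), ih,
      boxGenFun_succ_succ]
    ring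

theorem qInt_add (m n : ℕ) : qInt (m + n) = qInt m + X ^ m * qInt n := by
  simp [qInt, Finset.sum_range_add, Finset.mul_sum, pow_add]

theorem qInt_one : qInt 1 = 1 := by simp [qInt]

theorem qInt_dvd_qInt_mul (m n : ℕ) : qInt m ∣ qInt (m * n) := by
  induction n with
  | zero => simp [qInt]
  | succ n ih =>
    rw [Nat.mul_succ, qInt_add]
    exact dvd_add ih (dvd_mul_left _ _)

theorem isCoprime_qInt {m n : ℕ} (h : m.Coprime n) : IsCoprime (qInt m) (qInt n) := by
  induction m, n using Nat.gcd.induction with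
  | H0 n =>
    obtain rfl : n = 1 := by simpa using h
    rw [qInt_one]
    exact isCoprime_one_right
  | H1 m n _ ih =>
    obtain ⟨c, hc⟩ := qInt_dvd_qInt_mul m (n / m)
    rw [← Nat.mod_add_div n m, qInt_add, hc, mul_left_comm]
    refine (ih ?_).symm.add_mul_left_right _
    rwa [Nat.coprime_iff_gcd_eq_one, ← Nat.gcd_rec]

/-- The `q`-analogue of `Nat.add_one_mul_choose_eq`. -/
theorem qInt_mul_boxGenFun (k n : ℕ) :
    qInt (k + 1 + n) * boxGenFun k n = qInt (k + 1) * boxGenFun (k + 1) n := by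
  induction n generalizing k with
  | zero => simp
  | succ n ih =>
    have hright (k : ℕ) :
        qInt (k + 1 + n) * boxGenFun k n = qInt (n + 1) * boxGenFun k (n + 1) := by
      induction k with
      | zero => simp [add_comm]
      | succ k ihk =>
        rw [boxGenFun_succ_succ]
        have h : qInt (k + 1 + 1 + n) = qInt (n + 1) + X ^ (n + 1) * qInt (k + 1) := by
          rw [← qInt_add]; congr 1; omega
        linear_combination boxGenFun (k + 1) n * h - X ^ (n + 1) * (ih k) + X ^ (n + 1) * ihk
    have h : qInt (k + 1 + (n + 1)) = qInt (n + 1) + X ^ (n + 1) * qInt (k + 1) := by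
      rw [← qInt_add]; congr 1; omega
    rw [boxGenFun_succ_succ]
    linear_combination boxGenFun k (n + 1) * h - hright k + ih k

theorem qInt_dvd_boxGenFun {k n : ℕ} (h : (k + 1).Coprime (k + 1 + n)) :
    qInt (k + 1) ∣ boxGenFun k n :=
  (isCoprime_qInt h).dvd_of_dvd_mul_left ⟨_, qInt_mul_boxGenFun k n⟩

theorem isCoprime_qInt_X_pow {m : ℕ} (hm : 0 < m) (r : ℕ) : IsCoprime (qInt m) (X ^ r) := by
  obtain ⟨m, rfl⟩ := Nat.exists_eq_add_of_le' hm
  refine IsCoprime.pow_right ⟨1, -qInt m, ?_⟩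
  rw [add_comm m, qInt_add, qInt_one]
  ring

/-- The sum of the coefficients whose index is congruent to `r` modulo `m`. -/
noncomputable def residueSum (m r : ℕ) : ℤ[X] →ₗ[ℤ] ℤ :=
  Polynomial.lsum fun i => if i % m = r then LinearMap.id else 0

theorem residueSum_X_pow (m r i : ℕ) :
    residueSum m r (X ^ i) = if i % m = r then 1 else 0 := by
  rw [residueSum, Polynomial.lsum_apply, ← monomial_one_right_eq_X_pow,
    sum_monomial_index _ _ (by simp)]
  split_ifs <;> simp

theorem residueSum_qInt_mul {m r : ℕ} (hr : r < m) (P : ℤ[X]) :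
    residueSum m r (qInt m * P) = P.eval 1 := by
  induction P using Polynomial.induction_on' with
  | add p q hp hq => rw [mul_add, map_add, hp, hq, eval_add]
  | monomial n c =>
    have h : residueSum m r (qInt m * X ^ n) = 1 := by
      induction n with
      | zero =>
        simp only [qInt, pow_zero, mul_one, map_sum, residueSum_X_pow]
        rw [Finset.sum_eq_single_of_mem r (Finset.mem_range.2 hr), if_pos (Nat.mod_eq_of_lt hr)]
        intro i hi hir
        rw [Nat.mod_eq_of_lt (Finset.mem_range.1 hi), if_neg hir]
      | succ n ih =>
        have hgeom : qInt m * X ^ (n + 1) = qInt m * X ^ n + X ^ (n + m) - X ^ n := by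
          have := geom_sum_mul (X : ℤ[X]) m
          rw [qInt]
          linear_combination X ^ n * this
        rw [hgeom, map_sub, map_add, ih, residueSum_X_pow, residueSum_X_pow, Nat.add_mod_right,
          add_sub_cancel_right]
    rw [← C_mul_X_pow_eq_monomial, mul_left_comm, ← smul_eq_C_mul, map_smul, h]
    simp

theorem residueSum_X_pow_mul_boxGenFun (m r s k n : ℕ) :
    residueSum m r (X ^ s * boxGenFun k n) =
      ({l : List ℕ | IsPartition l ∧ l.length ≤ k ∧ (∀ x ∈ l, x ≤ n) ∧
        (l.sum + s) % m = r}.ncard : ℤ) := by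
  have h : {l : List ℕ | IsPartition l ∧ l.length ≤ k ∧ (∀ x ∈ l, x ≤ n) ∧
      (l.sum + s) % m = r} = ((boxPartitions k n).filter fun l => (l.sum + s) % m = r) := by
    ext l
    simp [mem_boxPartitions, and_assoc]
  rw [h, Set.ncard_coe_finset]
  simp [boxGenFun, Finset.mul_sum, ← pow_add, residueSum_X_pow, add_comm s]

theorem coprime_succ_of_mod_prime_ne {m n : ℕ}
    (h : ∀ p : ℕ, p.Prime → p ∣ m → n % p ≠ p - 1) : m.Coprime (n + 1) := by
  refine Nat.coprime_of_dvd fun p hp hpm hpn => h p hp hpm ?_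
  obtain ⟨c, hc⟩ := hpn
  obtain ⟨c, rfl⟩ := Nat.exists_eq_succ_of_ne_zero (n := c) (by rintro rfl; simp at hc)
  have := hp.pos
  obtain rfl : n = p - 1 + p * c := by rw [Nat.mul_succ] at hc; omega
  rw [Nat.add_mul_mod_self_left, Nat.mod_eq_of_lt (by omega)]

/-- sieved sums of shifted Gaussian binomials: under the stated
congruence conditions on `a` and `b`, `∑_{j=a+1}^b N_j(ℓ) = (1/m)·∑_{j=a+1}^b
C(j-1, m-2)` for every residue `ℓ`; in particular `m` divides the binomial sum. -/
theorem sieved_gaussian_sum (m a b : ℕ) (hm : 2 ≤ m) (hma : m ≤ a) (hab : a < b)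
    (ha : ∀ p : ℕ, p.Prime → p ∣ m → a % p ≠ p - 1)
    (hb : ∀ p : ℕ, p.Prime → p ∣ m → b % p ≠ p - 1) :
    m ∣ (∑ j ∈ Finset.Icc (a + 1) b, Nat.choose (j - 1) (m - 2)) ∧
    ∀ ℓ : ℕ, ℓ < m →
      (∑ j ∈ Finset.Icc (a + 1) b,
        {l : List ℕ | IsPartition l ∧ l.length ≤ m - 2 ∧ (∀ x ∈ l, x ≤ j - m + 1) ∧
          (l.sum + (j - (a + 1))) % m = ℓ}.ncard)
      = (∑ j ∈ Finset.Icc (a + 1) b, Nat.choose (j - 1) (m - 2)) / m := by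
  set S : ℤ[X] := ∑ j ∈ Finset.Icc (a + 1) b,
    X ^ (j - (a + 1)) * boxGenFun (m - 2) (j - m + 1) with hS
  have hdvd_box {n : ℕ} (hn : m ≤ n) (h : ∀ p : ℕ, p.Prime → p ∣ m → n % p ≠ p - 1) :
      qInt m ∣ boxGenFun (m - 1) (n - m + 1) := by
    have := qInt_dvd_boxGenFun (k := m - 1) (n := n - m + 1)
    rw [Nat.sub_add_cancel (by omega), show m + (n - m + 1) = n + 1 by omega] at this
    exact this (coprime_succ_of_mod_prime_ne h)
  have hshift : X ^ (a - m + 2) * S =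
      boxGenFun (m - 1) (b - m + 1) - boxGenFun (m - 1) (a - m + 1) := by
    have := sum_Ioc_X_pow_mul_boxGenFun (m - 2) (show a - m + 1 ≤ b - m + 1 by omega)
    rw [show m - 2 + 1 = m - 1 by omega] at this
    rw [← this, hS, Finset.mul_sum]
    refine Finset.sum_bij' (fun j _ => j - m + 1) (fun n _ => n + m - 1) ?_ ?_ ?_ ?_ ?_ <;>
      simp only [Finset.mem_Icc, Finset.mem_Ioc]
    · omega
    · omega
    · omega
    · omega
    · intro j hj
      rw [← mul_assoc, ← pow_add]
      congr 2
      omega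
  obtain ⟨P, hP⟩ : qInt m ∣ S := by
    refine (isCoprime_qInt_X_pow (by omega) (a - m + 2)).dvd_of_dvd_mul_left ?_
    rw [hshift]
    exact dvd_sub (hdvd_box (by omega) hb) (hdvd_box hma ha)
  have hsum : ((∑ j ∈ Finset.Icc (a + 1) b, Nat.choose (j - 1) (m - 2) : ℕ) : ℤ) =
      m * P.eval 1 := by
    have h : S.eval 1 = m * P.eval 1 := by
      rw [hP, eval_mul]
      simp [qInt, eval_finsetSum]
    rw [← h, hS, eval_finsetSum, Nat.cast_sum]
    refine Finset.sum_congr rfl fun j hj => ?_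
    rw [Finset.mem_Icc] at hj
    rw [eval_mul, eval_one_boxGenFun, show m - 2 + (j - m + 1) = j - 1 by omega]
    simp
  refine ⟨Int.natCast_dvd_natCast.1 ⟨_, hsum⟩, fun ℓ hℓ => ?_⟩
  have hm0 : (m : ℤ) ≠ 0 := by omega
  rw [← Nat.cast_inj (R := ℤ), Int.natCast_div, hsum, Int.mul_ediv_cancel_left _ hm0,
    ← residueSum_qInt_mul hℓ, ← hP, hS, map_sum, Nat.cast_sum]
  exact Finset.sum_congr rfl fun j _ => (residueSum_X_pow_mul_boxGenFun ..).symm
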